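/- For every c > 0 there exists a constant C < ∞ such that for all 0 < t ≤ c and all x, y ∈ ℝ: |∂²p̂/∂y²(t, x, y)| ≤ C (p̂(t, x, y)/t) (1 + √t + |S(y) − S(x)|/√t)². -/

import Mathlib

open Real MeasureTheory intervalIntegral

/-- `S(x) = ∫₀^x σ(u)⁻¹ du`. -/
noncomputable def Sfun (σ : ℝ → ℝ) (x : ℝ) : ℝ := ∫ u in (0 : ℝ)..x, (σ u)⁻¹

/-- `C(u) = m(u)/σ(u) − σ′(u)/2`. -/
noncomputable def Cfun (m σ : ℝ → ℝ) (u : ℝ) : ℝ := m u / σ u - deriv σ u / 2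

/-- `H(x) = ∫₀^{S(x)} C(u) du`. -/
noncomputable def Hfun (m σ : ℝ → ℝ) (x : ℝ) : ℝ := ∫ u in (0 : ℝ)..(Sfun σ x), Cfun m σ u

/-- `p̂(t, x, y) = (2π t)^{−1/2} σ(y)⁻¹ exp(−(S(y) − S(x))²/(2t) + H(y) − H(x))`. -/
noncomputable def phat (m σ : ℝ → ℝ) (t x y : ℝ) : ℝ :=
  (2 * Real.pi * t) ^ (-(1 : ℝ) / 2) * (σ y)⁻¹ *
    Real.exp (-(Sfun σ y - Sfun σ x) ^ 2 / (2 * t) + Hfun m σ y - Hfun m σ x)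

/-- The logarithmic derivative `∂_y log p̂(t, x, y)`. -/
noncomputable def phatLogDeriv (m σ : ℝ → ℝ) (t x y : ℝ) : ℝ :=
  (Cfun m σ (Sfun σ y) - deriv σ y - (Sfun σ y - Sfun σ x) / t) / σ y

/-- The derivative of `C`. -/
noncomputable def CfunDeriv (m σ : ℝ → ℝ) (u : ℝ) : ℝ :=
  (deriv m u * σ u - m u * deriv σ u) / σ u ^ 2 - iteratedDeriv 2 σ u / 2

lemma hasDerivAt_deriv_of_contDiff_two {f : ℝ → ℝ} (hf : ContDiff ℝ 2 f) (u : ℝ) :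
    HasDerivAt (deriv f) (iteratedDeriv 2 f u) u := by
  have h : Differentiable ℝ (deriv f) := by
    simpa using hf.differentiable_iteratedDeriv 1 (by norm_num)
  simpa [iteratedDeriv_succ] using (h u).hasDerivAt

lemma hasDerivAt_Sfun {σ : ℝ → ℝ} (hσ : Continuous σ) (h0 : ∀ x, σ x ≠ 0) (y : ℝ) :
    HasDerivAt (Sfun σ) (σ y)⁻¹ y := by
  have h : Continuous fun u => (σ u)⁻¹ := hσ.inv₀ h0
  exact (h.integral_hasStrictDerivAt 0 y).hasDerivAt

lemma hasDerivAt_Cfun {m σ : ℝ → ℝ} (hm : Differentiable ℝ m) (hσ : ContDiff ℝ 2 σ)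
    (h0 : ∀ x, σ x ≠ 0) (u : ℝ) : HasDerivAt (Cfun m σ) (CfunDeriv m σ u) u := by
  have h1 := (hσ.differentiable (by norm_num) u).hasDerivAt
  exact ((hm u).hasDerivAt.div h1 (h0 u)).sub
    ((hasDerivAt_deriv_of_contDiff_two hσ u).div_const 2)

lemma hasDerivAt_Hfun {m σ : ℝ → ℝ} (hm : Differentiable ℝ m) (hσ : ContDiff ℝ 2 σ)
    (h0 : ∀ x, σ x ≠ 0) (y : ℝ) :
    HasDerivAt (Hfun m σ) (Cfun m σ (Sfun σ y) * (σ y)⁻¹) y := by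
  have hC : Continuous (Cfun m σ) :=
    continuous_iff_continuousAt.2 fun u => (hasDerivAt_Cfun hm hσ h0 u).continuousAt
  exact HasDerivAt.comp y (hC.integral_hasStrictDerivAt 0 (Sfun σ y)).hasDerivAt
    (hasDerivAt_Sfun hσ.continuous h0 y)

lemma hasDerivAt_phat {m σ : ℝ → ℝ} (hm : Differentiable ℝ m) (hσ : ContDiff ℝ 2 σ)
    (h0 : ∀ x, σ x ≠ 0) {t : ℝ} (ht : t ≠ 0) (x y : ℝ) :
    HasDerivAt (fun y' => phat m σ t x y') (phat m σ t x y * phatLogDeriv m σ t x y) y := by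
  have h1 := (hσ.differentiable (by norm_num) y).hasDerivAt
  have hS := (hasDerivAt_Sfun hσ.continuous h0 y).sub_const (Sfun σ x)
  have hE := ((((hS.pow 2).neg.div_const (2 * t)).add
    (hasDerivAt_Hfun hm hσ h0 y)).sub_const (Hfun m σ x)).exp
  have := ((h1.inv (h0 y)).const_mul ((2 * Real.pi * t) ^ (-(1 : ℝ) / 2))).mul hE
  refine this.congr_deriv ?_
  have h0y := h0 y
  simp only [phat, phatLogDeriv, Pi.add_apply, Pi.pow_apply, Pi.neg_apply,
    Pi.inv_apply]
  field_simp
  ring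

lemma hasDerivAt_phatLogDeriv {m σ : ℝ → ℝ} (hm : Differentiable ℝ m) (hσ : ContDiff ℝ 2 σ)
    (h0 : ∀ x, σ x ≠ 0) (t x y : ℝ) :
    HasDerivAt (phatLogDeriv m σ t x)
      ((CfunDeriv m σ (Sfun σ y) / σ y - iteratedDeriv 2 σ y - 1 / (t * σ y)) / σ y
        - phatLogDeriv m σ t x y * (deriv σ y / σ y)) y := by
  have h1 := (hσ.differentiable (by norm_num) y).hasDerivAt
  have hS := hasDerivAt_Sfun hσ.continuous h0 y
  have hC := HasDerivAt.comp y (hasDerivAt_Cfun hm hσ h0 (Sfun σ y)) hS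
  have := (((hC.sub (hasDerivAt_deriv_of_contDiff_two hσ y)).sub
    ((hS.sub_const (Sfun σ x)).div_const t)).div h1 (h0 y))
  refine this.congr_deriv ?_
  have h0y := h0 y
  simp only [phatLogDeriv, Pi.sub_apply, Function.comp_apply]
  field_simp

lemma iteratedDeriv_two_phat {m σ : ℝ → ℝ} (hm : Differentiable ℝ m) (hσ : ContDiff ℝ 2 σ)
    (h0 : ∀ x, σ x ≠ 0) {t : ℝ} (ht : t ≠ 0) (x y : ℝ) :
    iteratedDeriv 2 (fun y' => phat m σ t x y') y = phat m σ t x y *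
      (phatLogDeriv m σ t x y ^ 2 +
        ((CfunDeriv m σ (Sfun σ y) / σ y - iteratedDeriv 2 σ y - 1 / (t * σ y)) / σ y
          - phatLogDeriv m σ t x y * (deriv σ y / σ y))) := by
  have h : deriv (fun y' => phat m σ t x y') =
      fun y' => phat m σ t x y' * phatLogDeriv m σ t x y' :=
    funext fun y' => (hasDerivAt_phat hm hσ h0 ht x y').deriv
  rw [iteratedDeriv_succ, iteratedDeriv_one, h]
  refine ((hasDerivAt_phat hm hσ h0 ht x y).mul
    (hasDerivAt_phatLogDeriv hm hσ h0 t x y)).deriv.trans ?_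
  ring

lemma abs_div_le_div_of_le {a b A l : ℝ} (hl : 0 < l) (hb : l ≤ b) (ha : |a| ≤ A) :
    |a / b| ≤ A / l := by
  rw [abs_div, abs_of_pos (hl.trans_le hb)]
  exact div_le_div₀ ((abs_nonneg a).trans ha) ha hl hb

lemma abs_Cfun_le {m σ : ℝ → ℝ} {M l u : ℝ} (hl : 0 < l) (hu : l ≤ σ u) (hm : |m u| ≤ M)
    (hσ : |deriv σ u| ≤ M) : |Cfun m σ u| ≤ M / l + M / 2 :=
  (abs_sub _ _).trans (add_le_add (abs_div_le_div_of_le hl hu hm)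
    (abs_div_le_div_of_le two_pos le_rfl hσ))

lemma abs_CfunDeriv_le {m σ : ℝ → ℝ} {M l u : ℝ} (hl : 0 < l) (hu : l ≤ σ u) (hm : |m u| ≤ M)
    (hm' : |deriv m u| ≤ M) (hσ : |σ u| ≤ M) (hσ' : |deriv σ u| ≤ M)
    (hσ'' : |iteratedDeriv 2 σ u| ≤ M) :
    |CfunDeriv m σ u| ≤ (M * M + M * M) / l ^ 2 + M / 2 := by
  have hM : 0 ≤ M := (abs_nonneg _).trans hm
  refine (abs_sub _ _).trans (add_le_add (abs_div_le_div_of_le (by positivity)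
    (by gcongr) ((abs_sub _ _).trans ?_)) (abs_div_le_div_of_le two_pos le_rfl hσ''))
  rw [abs_mul, abs_mul]
  gcongr

lemma phat_nonneg {m σ : ℝ → ℝ} {t y : ℝ} (ht : 0 < t) (hy : 0 < σ y) (x : ℝ) :
    0 ≤ phat m σ t x y := by
  unfold phat
  positivity

lemma abs_phatLogDeriv_le {m σ : ℝ → ℝ} {K l t y : ℝ} (hl : 0 < l) (hy : l ≤ σ y) (ht : 0 < t)
    (x : ℝ) (hK : |Cfun m σ (Sfun σ y) - deriv σ y| ≤ K) :
    |phatLogDeriv m σ t x y| ≤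
      (K + 1) / l * ((1 + √t + |Sfun σ y - Sfun σ x| / √t) / √t) := by
  have hr : 0 < √t := Real.sqrt_pos.2 ht
  have hK0 : 0 ≤ K := (abs_nonneg _).trans hK
  set D := Sfun σ y - Sfun σ x
  have hDt : |D / t| = |D| / √t / √t := by
    rw [abs_div, abs_of_pos ht, div_div, Real.mul_self_sqrt ht.le]
  have hw : 0 ≤ |D| / √t := by positivity
  have key : |Cfun m σ (Sfun σ y) - deriv σ y - D / t| ≤
      (K + 1) * ((1 + √t + |D| / √t) / √t) := by
    refine (abs_sub _ _).trans ?_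
    rw [hDt, ← mul_div_assoc, le_div_iff₀ hr, add_mul, div_mul_cancel₀ _ hr.ne']
    have := mul_le_mul_of_nonneg_right hK hr.le
    nlinarith [mul_nonneg hK0 hw]
  exact (abs_div_le_div_of_le hl hy key).trans_eq (by ring)

/-- For every `c > 0` there exists a constant `C < ∞` such that for all
`0 < t ≤ c` and all `x, y ∈ ℝ`:
`|∂²p̂/∂y²(t,x,y)| ≤ C (p̂(t,x,y)/t)(1 + √t + |S(y) − S(x)|/√t)²`. -/
theorem phat_second_deriv_y_bound
    (m σ : ℝ → ℝ) (hm : ContDiff ℝ 2 m) (hσ : ContDiff ℝ 2 σ)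
    (M : ℝ)
    (hmbd : ∀ x, |m x| ≤ M ∧ |deriv m x| ≤ M ∧ |iteratedDeriv 2 m x| ≤ M)
    (hσbd : ∀ x, |σ x| ≤ M ∧ |deriv σ x| ≤ M ∧ |iteratedDeriv 2 σ x| ≤ M)
    (σl σu : ℝ) (hσl : 0 < σl) (hσrange : ∀ x, σl ≤ σ x ∧ σ x ≤ σu)
    (c : ℝ) (hc : 0 < c) :
    ∃ C : ℝ, ∀ t : ℝ, 0 < t → t ≤ c → ∀ x y : ℝ,
      |iteratedDeriv 2 (fun y' => phat m σ t x y') y| ≤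
        C * (phat m σ t x y / t) *
          (1 + Real.sqrt t + |Sfun σ y - Sfun σ x| / Real.sqrt t) ^ 2 := by
  have hM : 0 ≤ M := (abs_nonneg _).trans (hmbd 0).1
  have hpos : ∀ x, 0 < σ x := fun x => hσl.trans_le (hσrange x).1
  have h0 : ∀ x, σ x ≠ 0 := fun x => (hpos x).ne'
  have hmd : Differentiable ℝ m := hm.differentiable (by norm_num)
  set K := M / σl + M / 2 + M
  set L := (K + 1) / σl
  set A := ((M * M + M * M) / σl ^ 2 + M / 2) / σl + M
  have hA0 : 0 ≤ A := by positivity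
  have hL0 : 0 ≤ L := by positivity
  refine ⟨L ^ 2 + ((A + 1 / σl) / σl + L * (M / σl)), fun t ht _ x y => ?_⟩
  have hr : 0 < √t := Real.sqrt_pos.2 ht
  set G := phatLogDeriv m σ t x y
  set Z := 1 + √t + |Sfun σ y - Sfun σ x| / √t with hZ
  have hw : 0 ≤ |Sfun σ y - Sfun σ x| / √t := by positivity
  have hZ1 : 1 ≤ Z := by linarith
  have hrZ : √t ≤ Z := by linarith
  have hq : 1 ≤ Z / √t := (one_le_div hr).2 hrZ
  have hqt : (Z / √t) ^ 2 = Z ^ 2 / t := by rw [div_pow, Real.sq_sqrt ht.le]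
  have hGle : |G| ≤ L * (Z / √t) :=
    abs_phatLogDeriv_le hσl (hσrange y).1 ht x ((abs_sub _ _).trans
      (add_le_add (abs_Cfun_le hσl (hσrange _).1 (hmbd _).1 (hσbd _).2.1) (hσbd y).2.1))
  have hsq : G ^ 2 ≤ L ^ 2 * (Z / √t) ^ 2 := by
    rw [← sq_abs, ← mul_pow]
    gcongr
  have hinv : |1 / (t * σ y)| ≤ 1 / σl * (Z / √t) ^ 2 := by
    rw [hqt, one_div_mul_eq_div, ← div_div]
    refine (abs_div_le_div_of_le hσl (hσrange y).1 (A := Z ^ 2 / t) ?_)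
    rw [abs_of_pos (by positivity)]
    gcongr
    exact one_le_pow₀ hZ1
  have hfst : |(CfunDeriv m σ (Sfun σ y) / σ y - iteratedDeriv 2 σ y - 1 / (t * σ y)) / σ y| ≤
      (A + 1 / σl) / σl * (Z / √t) ^ 2 := by
    have hAle : |CfunDeriv m σ (Sfun σ y) / σ y - iteratedDeriv 2 σ y| ≤ A :=
      (abs_sub _ _).trans (add_le_add (abs_div_le_div_of_le hσl (hσrange y).1
        (abs_CfunDeriv_le hσl (hσrange _).1 (hmbd _).1 (hmbd _).2.1 (hσbd _).1 (hσbd _).2.1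
          (hσbd _).2.2)) (hσbd y).2.2)
    have hAq : A ≤ A * (Z / √t) ^ 2 := le_mul_of_one_le_right hA0 (one_le_pow₀ hq)
    refine (abs_div_le_div_of_le hσl (hσrange y).1 ((abs_sub _ _).trans
      (add_le_add (hAle.trans hAq) hinv))).trans_eq ?_
    ring
  have hsnd : |G * (deriv σ y / σ y)| ≤ L * (M / σl) * (Z / √t) ^ 2 := by
    rw [abs_mul]
    calc |G| * |deriv σ y / σ y| ≤ L * (Z / √t) * (M / σl) := by
          gcongr
          exact abs_div_le_div_of_le hσl (hσrange y).1 (hσbd y).2.1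
      _ ≤ L * (Z / √t) ^ 2 * (M / σl) := by
          gcongr
          exact le_self_pow₀ hq two_ne_zero
      _ = L * (M / σl) * (Z / √t) ^ 2 := by ring
  have hp := phat_nonneg (m := m) ht (hpos y) x
  rw [iteratedDeriv_two_phat hmd hσ h0 ht.ne' x y, abs_mul, abs_of_nonneg hp]
  calc _ ≤ phat m σ t x y *
        ((L ^ 2 + ((A + 1 / σl) / σl + L * (M / σl))) * (Z / √t) ^ 2) := by
        refine mul_le_mul_of_nonneg_left ((abs_add_le _ _).trans ?_) hp
        rw [abs_of_nonneg (sq_nonneg _), add_mul, add_mul]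
        exact add_le_add hsq ((abs_sub _ _).trans (add_le_add hfst hsnd))
    _ = _ := by
        rw [hqt]
        ring
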